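/- Let γ > 3 and λ ≠ 1. There exist positive constants K₅, K₆ depending only on C₀, γ, K, λ and α such that the following holds: suppose the initial data (τ₀,u₀) ∈ C¹(ℝ) satisfy |u₀(x)| ≤ C₀ and C₀⁻¹ < τ₀(x) for all x, for some constant C₀ > 0, and let (τ,u) be a C¹ solution of the system on ℝ × [0,∞). If there exists a point x₀ such that u_x(x₀,0) + φ_x(x₀,0) < K₅ φ(x₀,0)^{−2/(γ−1)} − K₆ φ(x₀,0)^{−(γ+1)/(2(γ−1))}, or u_x(x₀,0) − φ_x(x₀,0) < K₅ φ(x₀,0)^{−2/(γ−1)} − K₆ φ(x₀,0)^{−(γ+1)/(2(γ−1))}, then ‖(τ_x,u_x)‖_{L∞} blows up in finite time. -/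

import Mathlib

open Real Set MeasureTheory

/-- Partial derivative in the space variable `x`. -/
noncomputable def pdx (f : ℝ → ℝ → ℝ) (x t : ℝ) : ℝ := deriv (fun y => f y t) x

/-- Partial derivative in the time variable `t`. -/
noncomputable def pdt (f : ℝ → ℝ → ℝ) (x t : ℝ) : ℝ := deriv (fun s => f x s) t

/-- `(τ, u)` is a `C¹` solution of the compressible Euler equations with
time-dependent damping `τ_t - u_x = 0`, `u_t + p_x = -(α/(1+t)^λ) u`,
`p = K τ^{-γ}`, on `ℝ × [0,∞)`. -/
def IsSol (K γ α lam : ℝ) (τ u : ℝ → ℝ → ℝ) : Prop :=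
  ContDiff ℝ 1 (fun p : ℝ × ℝ => τ p.1 p.2) ∧
  ContDiff ℝ 1 (fun p : ℝ × ℝ => u p.1 p.2) ∧
  (∀ x t, 0 ≤ t → 0 < τ x t) ∧
  (∀ x t, 0 ≤ t → pdt τ x t = pdx u x t) ∧
  (∀ x t, 0 ≤ t →
    pdt u x t + pdx (fun y s => K * τ y s ^ (-γ)) x t = -(α / (1 + t) ^ lam) * u x t)

/-- `φ = (2√(Kγ)/(γ-1)) τ^{-(γ-1)/2}`. -/
noncomputable def Phi (K γ : ℝ) (τ : ℝ → ℝ → ℝ) (x t : ℝ) : ℝ :=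
  (2 * Real.sqrt (K * γ) / (γ - 1)) * τ x t ^ (-(γ - 1) / 2)

/-- `K_τ = (2√(Kγ)/(γ-1))^{2/(γ-1)}`. -/
noncomputable def Ktau (K γ : ℝ) : ℝ := (2 * Real.sqrt (K * γ) / (γ - 1)) ^ (2 / (γ - 1))

/-- `K_c = √(Kγ) K_τ^{-(γ+1)/2}`. -/
noncomputable def Kc (K γ : ℝ) : ℝ := Real.sqrt (K * γ) * Ktau K γ ^ (-(γ + 1) / 2)

/-- Blow-up of `‖(τ_x, u_x)‖_{L^∞}` in finite time. -/
def BlowsUp (τ u : ℝ → ℝ → ℝ) : Prop :=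
  ∃ T > (0 : ℝ),
    ¬ BddAbove {r : ℝ | ∃ x t, 0 ≤ t ∧ t ≤ T ∧ r = |pdx τ x t| + |pdx u x t|}

/-- The Lagrangian sound speed `√(-p'(τ)) = √(Kγ) τ^{-(γ+1)/2}`. -/
noncomputable def soundSpeed (K γ : ℝ) (τ : ℝ → ℝ → ℝ) (x t : ℝ) : ℝ :=
  Real.sqrt (K * γ) * τ x t ^ (-(γ + 1) / 2)

section PartialDerivatives

variable {f : ℝ → ℝ → ℝ}

lemma pdx_eq_fderiv (hf : ContDiff ℝ 1 (fun p : ℝ × ℝ => f p.1 p.2)) (x t : ℝ) :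
    pdx f x t = fderiv ℝ (fun p : ℝ × ℝ => f p.1 p.2) (x, t) (1, 0) := by
  have h := (hf.differentiable one_ne_zero (x, t)).hasFDerivAt
  have h2 : HasDerivAt (fun y : ℝ => (y, t)) ((1 : ℝ), (0 : ℝ)) x :=
    (hasDerivAt_id x).prodMk (hasDerivAt_const x t)
  exact (h.comp_hasDerivAt x h2).deriv

lemma pdt_eq_fderiv (hf : ContDiff ℝ 1 (fun p : ℝ × ℝ => f p.1 p.2)) (x t : ℝ) :
    pdt f x t = fderiv ℝ (fun p : ℝ × ℝ => f p.1 p.2) (x, t) (0, 1) := by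
  have h := (hf.differentiable one_ne_zero (x, t)).hasFDerivAt
  have h2 : HasDerivAt (fun s : ℝ => (x, s)) ((0 : ℝ), (1 : ℝ)) t :=
    (hasDerivAt_const t x).prodMk (hasDerivAt_id t)
  exact (h.comp_hasDerivAt t h2).deriv

lemma continuous_pdx (hf : ContDiff ℝ 1 (fun p : ℝ × ℝ => f p.1 p.2)) :
    Continuous (fun p : ℝ × ℝ => pdx f p.1 p.2) := by
  simp only [pdx_eq_fderiv hf]
  exact (hf.continuous_fderiv one_ne_zero).clm_apply continuous_const

lemma hasDerivWithinAt_along_curve (hf : ContDiff ℝ 1 (fun p : ℝ × ℝ => f p.1 p.2))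
    {X Θ : ℝ → ℝ} {X' Θ' s : ℝ} {S : Set ℝ}
    (hX : HasDerivWithinAt X X' S s) (hΘ : HasDerivWithinAt Θ Θ' S s) :
    HasDerivWithinAt (fun r => f (X r) (Θ r))
      (X' * pdx f (X s) (Θ s) + Θ' * pdt f (X s) (Θ s)) S s := by
  have h := (hf.differentiable one_ne_zero (X s, Θ s)).hasFDerivAt
  have h2 := h.comp_hasDerivWithinAt s (hX.prodMk hΘ)
  refine h2.congr_deriv ?_
  rw [pdx_eq_fderiv hf, pdt_eq_fderiv hf]
  have : (X', Θ') = X' • ((1 : ℝ), (0 : ℝ)) + Θ' • ((0 : ℝ), (1 : ℝ)) := by simp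
  rw [this, map_add, map_smul, map_smul, smul_eq_mul, smul_eq_mul]

lemma hasDerivAt_pdx (hf : ContDiff ℝ 1 (fun p : ℝ × ℝ => f p.1 p.2)) (x t : ℝ) :
    HasDerivAt (fun y => f y t) (pdx f x t) x := by
  have h := hasDerivWithinAt_along_curve hf (hasDerivWithinAt_id x univ)
    (hasDerivWithinAt_const x univ t)
  simpa [hasDerivWithinAt_univ] using h

lemma hasDerivAt_pdt (hf : ContDiff ℝ 1 (fun p : ℝ × ℝ => f p.1 p.2)) (x t : ℝ) :
    HasDerivAt (fun s => f x s) (pdt f x t) t := by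
  have h := hasDerivWithinAt_along_curve hf (hasDerivWithinAt_const t univ x)
    (hasDerivWithinAt_id t univ)
  simpa [hasDerivWithinAt_univ] using h

end PartialDerivatives

section Pressure

variable {K γ α lam : ℝ} {τ u : ℝ → ℝ → ℝ}

lemma soundSpeed_nonneg {x t : ℝ} (h : 0 < τ x t) : 0 ≤ soundSpeed K γ τ x t :=
  mul_nonneg (Real.sqrt_nonneg _) (Real.rpow_nonneg h.le _)

lemma hasDerivWithinAt_Phi_along_curve (hγ : 1 < γ) {X Θ : ℝ → ℝ} {D s : ℝ} {S : Set ℝ}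
    (hτ : HasDerivWithinAt (fun r => τ (X r) (Θ r)) D S s) (hpos : 0 < τ (X s) (Θ s)) :
    HasDerivWithinAt (fun r => Phi K γ τ (X r) (Θ r))
      (-soundSpeed K γ τ (X s) (Θ s) * D) S s := by
  have h := (hτ.rpow_const (p := -(γ - 1) / 2) (Or.inl hpos.ne')).const_mul
    (2 * Real.sqrt (K * γ) / (γ - 1))
  refine h.congr_deriv ?_
  have h1 : γ - 1 ≠ 0 := by linarith
  rw [show -(γ - 1) / 2 - 1 = -(γ + 1) / 2 by ring, soundSpeed]
  field_simp

lemma hasDerivWithinAt_soundSpeed_along_curve {X Θ : ℝ → ℝ} {D s : ℝ} {S : Set ℝ}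
    (hτ : HasDerivWithinAt (fun r => τ (X r) (Θ r)) D S s) (hpos : 0 < τ (X s) (Θ s)) :
    HasDerivWithinAt (fun r => soundSpeed K γ τ (X r) (Θ r))
      (-((γ + 1) / 2) * soundSpeed K γ τ (X s) (Θ s) / τ (X s) (Θ s) * D) S s := by
  have h := (hτ.rpow_const (p := -(γ + 1) / 2) (Or.inl hpos.ne')).const_mul
    (Real.sqrt (K * γ))
  refine h.congr_deriv ?_
  rw [soundSpeed, Real.rpow_sub_one hpos.ne']
  ring

lemma pdx_Phi (hγ : 1 < γ) (hτ : ContDiff ℝ 1 (fun p : ℝ × ℝ => τ p.1 p.2)) {x t : ℝ}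
    (hpos : 0 < τ x t) : pdx (Phi K γ τ) x t = -soundSpeed K γ τ x t * pdx τ x t := by
  have h := hasDerivWithinAt_Phi_along_curve (K := K) hγ (X := id) (Θ := fun _ => t) (s := x)
    (S := univ)     (hasDerivAt_pdx hτ x t).hasDerivWithinAt hpos
  exact (hasDerivWithinAt_univ.1 h).deriv

lemma soundSpeed_sq (hK : 0 < K) (hγ : 0 < γ) {x t : ℝ} (hpos : 0 < τ x t) :
    soundSpeed K γ τ x t ^ 2 = K * γ * τ x t ^ (-γ - 1) := by
  rw [soundSpeed, mul_pow, Real.sq_sqrt (mul_pos hK hγ).le, ← Real.rpow_natCast,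
    ← Real.rpow_mul hpos.le]
  congr 2
  push_cast
  ring

lemma pdt_velocity (hK : 0 < K) (hγ : 0 < γ) (hsol : IsSol K γ α lam τ u) {x t : ℝ}
    (ht : 0 ≤ t) : pdt u x t =
      -(α / (1 + t) ^ lam) * u x t + soundSpeed K γ τ x t ^ 2 * pdx τ x t := by
  obtain ⟨hτ, -, hpos, -, hmom⟩ := hsol
  have h : pdx (fun y s => K * τ y s ^ (-γ)) x t =
      -(soundSpeed K γ τ x t ^ 2 * pdx τ x t) := by
    rw [soundSpeed_sq hK hγ (hpos x t ht)]
    refine (((hasDerivAt_pdx hτ x t).rpow_const (p := -γ)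
      (Or.inl (hpos x t ht).ne')).const_mul K).deriv.trans ?_
    ring
  linarith [hmom x t ht]

end Pressure

section InvariantRegion

variable {K γ α lam : ℝ} {τ u : ℝ → ℝ → ℝ}

lemma HasDerivWithinAt.nonpos_of_isMaxOn_Icc {H : ℝ → ℝ} {d b : ℝ} (hb : 0 < b)
    (hd : HasDerivWithinAt H d (Ici 0) 0) (hmax : ∀ h ∈ Icc 0 b, H h ≤ H 0) : d ≤ 0 := by
  by_contra! hpos
  have h1 := hd.Ioi_of_Ici
  rw [hasDerivWithinAt_iff_tendsto_slope' (by simp)] at h1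
  have h2 := h1.eventually (lt_mem_nhds hpos)
  have h3 : ∀ᶠ h in nhdsWithin (0 : ℝ) (Ioi 0), h ∈ Ioo 0 b := Ioo_mem_nhdsGT hb
  obtain ⟨h, hs, hh⟩ := (h2.and h3).exists
  rw [slope_def_field] at hs
  have := hmax h ⟨hh.1.le, hh.2.le⟩
  have h5 : (H h - H 0) / (h - 0) ≤ 0 :=
    div_nonpos_of_nonpos_of_nonneg (by linarith) (by linarith [hh.1])
  linarith

lemma hasDerivWithinAt_riemann_along_characteristic (hK : 0 < K) (hγ : 1 < γ)
    (hsol : IsSol K γ α lam τ u) {σ : ℝ} (hσ : σ ^ 2 = 1) {X Θ : ℝ → ℝ} {Θ' s : ℝ} {S : Set ℝ}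
    (hs : 0 ≤ Θ s)
    (hX : HasDerivWithinAt X (Θ' * (σ * soundSpeed K γ τ (X s) (Θ s))) S s)
    (hΘ : HasDerivWithinAt Θ Θ' S s) :
    HasDerivWithinAt (fun r => u (X r) (Θ r) + σ * Phi K γ τ (X r) (Θ r))
      (-Θ' * (α / (1 + Θ s) ^ lam) * u (X s) (Θ s)) S s := by
  have hu := hasDerivWithinAt_along_curve hsol.2.1 hX hΘ
  have hφ := hasDerivWithinAt_Phi_along_curve (K := K) hγ
    (hasDerivWithinAt_along_curve hsol.1 hX hΘ) (hsol.2.2.1 _ _ hs)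
  refine (hu.add (hφ.const_mul σ)).congr_deriv ?_
  rw [pdt_velocity hK (by linarith) hsol hs, hsol.2.2.2.1 _ _ hs]
  linear_combination (-Θ' * soundSpeed K γ τ (X s) (Θ s) ^ 2 * pdx τ (X s) (Θ s)) * hσ

lemma continuousOn_Phi (hsol : IsSol K γ α lam τ u) :
    ContinuousOn (fun p : ℝ × ℝ => Phi K γ τ p.1 p.2) {p | 0 ≤ p.2} := by
  refine continuousOn_const.mul (hsol.1.continuous.continuousOn.rpow_const fun p hp => ?_)
  exact Or.inl (hsol.2.2.1 _ _ hp).ne'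

lemma Phi_add_abs_le_of_soundSpeed_le (hK : 0 < K) (hγ : 1 < γ) (hα : 0 ≤ α)
    (hsol : IsSol K γ α lam τ u) {T Λ M : ℝ}
    (hΛ : ∀ x t, 0 ≤ t → t ≤ T → soundSpeed K γ τ x t ≤ Λ)
    (hM : ∀ x, Phi K γ τ x 0 + |u x 0| ≤ M) {x₁ t₁ : ℝ} (ht₁ : 0 ≤ t₁) (ht₁T : t₁ ≤ T) :
    Phi K γ τ x₁ t₁ + |u x₁ t₁| ≤ M := by
  have hΛ0 : 0 ≤ Λ :=
    (soundSpeed_nonneg (hsol.2.2.1 x₁ t₁ ht₁)).trans (hΛ x₁ t₁ ht₁ ht₁T)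
  suffices h : ∀ η > 0, Phi K γ τ x₁ t₁ + |u x₁ t₁| - η * t₁ ≤ M by
    refine le_of_forall_pos_le_add fun ε hε => ?_
    have h1 := h (ε / (t₁ + 1)) (by positivity)
    have h2 : ε / (t₁ + 1) * t₁ ≤ ε := by
      rw [div_mul_eq_mul_div, div_le_iff₀ (by linarith)]
      nlinarith
    linarith
  intro η hη
  set D : Set (ℝ × ℝ) := {p | 0 ≤ p.2 ∧ p.2 ≤ t₁ ∧ |p.1 - x₁| ≤ Λ * (t₁ - p.2)} with hD
  have hDclosed : IsClosed D := by
    have h1 : IsClosed {p : ℝ × ℝ | 0 ≤ p.2} := isClosed_le (by fun_prop) (by fun_prop)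
    have h2 : IsClosed {p : ℝ × ℝ | p.2 ≤ t₁} := isClosed_le (by fun_prop) (by fun_prop)
    have h3 : IsClosed {p : ℝ × ℝ | |p.1 - x₁| ≤ Λ * (t₁ - p.2)} :=
      isClosed_le (by fun_prop) (by fun_prop)
    exact h1.inter (h2.inter h3)
  have hDsub : D ⊆ Icc (x₁ - Λ * t₁) (x₁ + Λ * t₁) ×ˢ Icc 0 t₁ := by
    rintro ⟨x, t⟩ ⟨h0, h1, h2⟩
    simp only at h0 h1 h2
    have := abs_le.1 h2
    have h3 : Λ * (t₁ - t) ≤ Λ * t₁ := mul_le_mul_of_nonneg_left (by linarith) hΛ0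
    exact ⟨⟨by linarith, by linarith⟩, h0, h1⟩
  have hDcomp : IsCompact D := (isCompact_Icc.prod isCompact_Icc).of_isClosed_subset hDclosed hDsub
  have hmem : (x₁, t₁) ∈ D := ⟨ht₁, le_rfl, by simp⟩
  have hcont : ContinuousOn
      (fun p : ℝ × ℝ => Phi K γ τ p.1 p.2 + |u p.1 p.2| - η * p.2) D := by
    refine (((continuousOn_Phi hsol).mono fun p hp => hp.1).add ?_).sub (by fun_prop)
    exact hsol.2.1.continuous.abs.continuousOn
  obtain ⟨⟨x, t⟩, hxt, hmax⟩ := hDcomp.exists_isMaxOn ⟨_, hmem⟩ hcont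
  obtain ⟨ht0, htt₁, hx⟩ := id hxt
  simp only at ht0 htt₁ hx
  have h1 := hmax hmem
  simp only [mem_ofPred_eq] at h1
  rcases ht0.eq_or_lt with rfl | htpos
  · linarith [hM x, mul_zero η]
  exfalso
  obtain ⟨σ, hσ, hσu⟩ : ∃ σ : ℝ, (σ = 1 ∨ σ = -1) ∧ |u x t| = σ * u x t := by
    rcases le_total 0 (u x t) with h | h
    · exact ⟨1, Or.inl rfl, by rw [abs_of_nonneg h, one_mul]⟩
    · exact ⟨-1, Or.inr rfl, by rw [abs_of_nonpos h, neg_one_mul]⟩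
  have hσ2 : σ ^ 2 = 1 := by rcases hσ with rfl | rfl <;> norm_num
  have hσle (v : ℝ) : σ * v ≤ |v| := by
    rcases hσ with rfl | rfl
    · simpa using le_abs_self v
    · simpa using neg_le_abs v
  set c := soundSpeed K γ τ x t with hc
  have hc0 : 0 ≤ c := soundSpeed_nonneg (hsol.2.2.1 x t ht0)
  have hcΛ : c ≤ Λ := hΛ x t ht0 (htt₁.trans ht₁T)
  have hX : HasDerivWithinAt (fun h : ℝ => x - h * (σ * c)) (-1 * (σ * c)) (Ici 0) 0 := by
    have := ((hasDerivWithinAt_id (0 : ℝ) (Ici 0)).mul_const (σ * c)).const_sub x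
    simpa using this
  have hΘ : HasDerivWithinAt (fun h : ℝ => t - h) (-1) (Ici 0) 0 :=
    (hasDerivWithinAt_id (0 : ℝ) (Ici 0)).const_sub t
  have hG := hasDerivWithinAt_riemann_along_characteristic hK hγ hsol hσ2
    (X := fun h : ℝ => x - h * (σ * c)) (Θ := fun h : ℝ => t - h) (s := 0) (S := Ici 0)
    (by simpa using ht0) (by simpa [hc] using hX) hΘ
  have hH := (hG.const_mul σ).sub (hΘ.const_mul η)
  have hle := HasDerivWithinAt.nonpos_of_isMaxOn_Icc htpos hH ?_
  · have ha : 0 ≤ α / (1 + t) ^ lam := div_nonneg hα (Real.rpow_nonneg (by linarith) _)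
    simp only [zero_mul, sub_zero] at hle
    have : 0 ≤ α / (1 + t) ^ lam * |u x t| := mul_nonneg ha (abs_nonneg _)
    rw [hσu] at this
    linarith
  · rintro h ⟨hh0, hht⟩
    have hmem' : (x - h * (σ * c), t - h) ∈ D := by
      refine ⟨by simpa using hht, by simp only; linarith, ?_⟩
      have e1 : |h * (σ * c)| = h * c := by
        rw [abs_mul, abs_mul, abs_of_nonneg hh0, abs_of_nonneg hc0]
        rcases hσ with rfl | rfl <;> simp
      have e2 : |x - h * (σ * c) - x₁| ≤ |x - x₁| + |h * (σ * c)| := by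
        rw [show x - h * (σ * c) - x₁ = (x - x₁) - h * (σ * c) by ring]
        exact abs_sub _ _
      simp only
      have e3 : h * c ≤ h * Λ := mul_le_mul_of_nonneg_left hcΛ hh0
      rw [e1] at e2
      linarith
    have h3 := hmax hmem'
    simp only [mem_ofPred_eq] at h3
    have h4 := hσle (u (x - h * (σ * c)) (t - h))
    simp only [Pi.sub_apply, zero_mul, sub_zero]
    have e4 (a b : ℝ) : σ * (a + σ * b) = σ * a + b := by linear_combination b * hσ2
    rw [e4, e4]
    linarith

end InvariantRegion

section LowerBound

variable {K γ α lam : ℝ} {τ u : ℝ → ℝ → ℝ}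

lemma soundSpeed_le_of_le (hγ : 0 < γ) {ε x t : ℝ} (hε : 0 < ε) (h : ε ≤ τ x t) :
    soundSpeed K γ τ x t ≤ Real.sqrt (K * γ) * ε ^ (-(γ + 1) / 2) :=
  mul_le_mul_of_nonneg_left (Real.rpow_le_rpow_of_nonpos hε h (by linarith)) (Real.sqrt_nonneg _)

lemma Phi_le_of_le (hγ : 1 < γ) {ε x t : ℝ} (hε : 0 < ε) (h : ε ≤ τ x t) :
    Phi K γ τ x t ≤ 2 * Real.sqrt (K * γ) / (γ - 1) * ε ^ (-(γ - 1) / 2) := by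
  have h1 : 0 < γ - 1 := by linarith
  exact mul_le_mul_of_nonneg_left (Real.rpow_le_rpow_of_nonpos hε h (by linarith))
    (by positivity)

lemma le_of_Phi_le (hK : 0 < K) (hγ : 1 < γ) {M x t : ℝ} (hpos : 0 < τ x t)
    (h : Phi K γ τ x t ≤ M) :
    (M / (2 * Real.sqrt (K * γ) / (γ - 1))) ^ (-2 / (γ - 1)) ≤ τ x t := by
  have h1 : 0 < γ - 1 := by linarith
  have hA : 0 < 2 * Real.sqrt (K * γ) / (γ - 1) := by
    have : 0 < Real.sqrt (K * γ) := Real.sqrt_pos.2 (mul_pos hK (by linarith))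
    positivity
  have h2 : τ x t ^ (-(γ - 1) / 2) ≤ M / (2 * Real.sqrt (K * γ) / (γ - 1)) := by
    rw [le_div_iff₀ hA, mul_comm]
    exact h
  have h3 := Real.rpow_le_rpow_of_nonpos (z := -2 / (γ - 1)) (Real.rpow_pos_of_pos hpos _) h2
    (div_nonpos_of_nonpos_of_nonneg (by norm_num) h1.le)
  rw [← Real.rpow_mul hpos.le] at h3
  rwa [show -(γ - 1) / 2 * (-2 / (γ - 1)) = 1 by field_simp, Real.rpow_one] at h3

lemma exists_pos_le_tau (hK : 0 < K) (hγ : 1 < γ) {C₀ : ℝ} (hC₀ : 0 < C₀) :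
    ∃ m > (0 : ℝ), ∀ (α lam : ℝ) (τ u : ℝ → ℝ → ℝ), 0 ≤ α → IsSol K γ α lam τ u →
      (∀ x, |u x 0| ≤ C₀) → (∀ x, C₀⁻¹ < τ x 0) →
      ∀ B T : ℝ, (∀ x t, 0 ≤ t → t ≤ T → |pdx τ x t| + |pdx u x t| ≤ B) →
        ∀ x t, 0 ≤ t → t ≤ T → m ≤ τ x t := by
  have h1 : 0 < γ - 1 := by linarith
  have hs : 0 < Real.sqrt (K * γ) := Real.sqrt_pos.2 (mul_pos hK (by linarith))
  set M : ℝ := 2 * Real.sqrt (K * γ) / (γ - 1) * C₀⁻¹ ^ (-(γ - 1) / 2) + C₀ with hM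
  set m : ℝ := (M / (2 * Real.sqrt (K * γ) / (γ - 1))) ^ (-2 / (γ - 1)) with hm
  have hMpos : 0 < M := by positivity
  have hmpos : 0 < m := Real.rpow_pos_of_pos (by positivity) _
  refine ⟨m, hmpos, fun α lam τ u hα hsol hu0 hτ0 B T hB => ?_⟩
  by_cases hT : 0 ≤ T
  swap
  · intro x t h2 h3
    exact absurd (h2.trans h3) hT
  have hB0 : 0 ≤ B := le_trans (by positivity) (hB 0 0 le_rfl hT)
  have hinit (x : ℝ) : Phi K γ τ x 0 + |u x 0| ≤ M :=
    add_le_add (Phi_le_of_le hγ (inv_pos.2 hC₀) (hτ0 x).le) (hu0 x)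
  set δ : ℝ := m / (2 * (B + 1)) with hδ
  have hδpos : 0 < δ := by positivity
  have hBδ : B * δ ≤ m / 2 := by
    rw [hδ, mul_div_assoc', div_le_div_iff₀ (by positivity) (by norm_num)]
    nlinarith
  have key (n : ℕ) : ∀ x t, 0 ≤ t → t ≤ T → t ≤ n * δ → m ≤ τ x t := by
    induction n with
    | zero =>
      intro x t ht0 htT htn
      have : t = 0 := le_antisymm (by simpa using htn) ht0
      subst this
      exact le_of_Phi_le hK hγ (hsol.2.2.1 x 0 le_rfl)
        (le_trans (le_add_of_nonneg_right (abs_nonneg _)) (hinit x))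
    | succ n ih =>
      have half (y s : ℝ) (hs0 : 0 ≤ s) (hsT : s ≤ T) (hsn : s ≤ (n + 1 : ℕ) * δ) :
          m / 2 ≤ τ y s := by
        rcases le_or_gt s (n * δ) with hle | hgt
        · linarith [ih y s hs0 hsT hle]
        have hn0 : 0 ≤ (n : ℝ) * δ := by positivity
        have h2 := ih y (n * δ) hn0 (hgt.le.trans hsT) le_rfl
        have h3 := (convex_Icc ((n : ℝ) * δ) s).norm_image_sub_le_of_norm_hasDerivWithin_le
          (f := fun r => τ y r) (f' := fun r => pdt τ y r) (C := B)
          (fun r _ => (hasDerivAt_pdt hsol.1 y r).hasDerivWithinAt) ?_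
          (left_mem_Icc.2 hgt.le) (right_mem_Icc.2 hgt.le)
        · rw [Real.norm_eq_abs, Real.norm_eq_abs, abs_of_nonneg (sub_nonneg.2 hgt.le)] at h3
          have h4 : B * (s - n * δ) ≤ B * δ := by
            push_cast at hsn
            exact mul_le_mul_of_nonneg_left (by linarith) hB0
          have := (abs_le.1 h3).1
          linarith
        · rintro r ⟨hr1, hr2⟩
          rw [Real.norm_eq_abs, hsol.2.2.2.1 y r (hn0.trans hr1)]
          linarith [hB y r (hn0.trans hr1) (hr2.trans hsT), abs_nonneg (pdx τ y r)]
      intro x t ht0 htT htn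
      have h2 := Phi_add_abs_le_of_soundSpeed_le hK hγ hα hsol (T := t)
        (fun y s hs0 hst => soundSpeed_le_of_le (by linarith) (half_pos hmpos)
          (half y s hs0 (hst.trans htT) (hst.trans htn))) hinit (x₁ := x) ht0 le_rfl
      exact le_of_Phi_le hK hγ (hsol.2.2.1 x t ht0)
        (le_trans (le_add_of_nonneg_right (abs_nonneg _)) h2)
  intro x t ht0 htT
  obtain ⟨n, hn⟩ := exists_nat_ge (t / δ)
  exact key n x t ht0 htT ((div_le_iff₀ hδpos).1 hn)

end LowerBound

section Characteristics

variable {K γ α lam : ℝ} {τ u : ℝ → ℝ → ℝ}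

lemma hasDerivAt_soundSpeed (hτ : ContDiff ℝ 1 (fun p : ℝ × ℝ => τ p.1 p.2)) {x t : ℝ}
    (hpos : 0 < τ x t) :
    HasDerivAt (fun y => soundSpeed K γ τ y t)
      (-((γ + 1) / 2) * soundSpeed K γ τ x t / τ x t * pdx τ x t) x := by
  have h := hasDerivWithinAt_soundSpeed_along_curve (K := K) (γ := γ) (X := id)
    (Θ := fun _ => t) (s := x) (S := univ) (hasDerivAt_pdx hτ x t).hasDerivWithinAt hpos
  exact hasDerivWithinAt_univ.1 h

lemma exists_lipschitz_soundSpeed (hγ : 0 < γ)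
    (hτ : ContDiff ℝ 1 (fun p : ℝ × ℝ => τ p.1 p.2)) {m B T : ℝ} (hm : 0 < m)
    (hlow : ∀ x t, 0 ≤ t → t ≤ T → m ≤ τ x t)
    (hB : ∀ x t, 0 ≤ t → t ≤ T → |pdx τ x t| ≤ B) :
    ∃ L : NNReal, ∀ t, 0 ≤ t → t ≤ T → LipschitzWith L (fun y => soundSpeed K γ τ y t) := by
  set Λ := Real.sqrt (K * γ) * m ^ (-(γ + 1) / 2) with hΛ
  have hΛ0 : 0 ≤ Λ := by positivity
  refine ⟨((γ + 1) / 2 * Λ / m * B).toNNReal, fun t ht0 htT => ?_⟩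
  have hpos (x : ℝ) : 0 < τ x t := hm.trans_le (hlow x t ht0 htT)
  have hB0 : 0 ≤ B := (abs_nonneg _).trans (hB 0 t ht0 htT)
  refine lipschitzWith_of_nnnorm_deriv_le
    (fun x => (hasDerivAt_soundSpeed hτ (hpos x)).differentiableAt) fun x => ?_
  rw [(hasDerivAt_soundSpeed hτ (hpos x)).deriv, ← NNReal.coe_le_coe, coe_nnnorm,
    Real.coe_toNNReal _ (by positivity), Real.norm_eq_abs, abs_mul, abs_div, abs_mul, abs_neg,
    abs_of_nonneg (soundSpeed_nonneg (hpos x)), abs_of_pos (hpos x), abs_of_pos (by positivity)]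
  have hc := soundSpeed_le_of_le (K := K) hγ hm (hlow x t ht0 htT)
  have h1 := hlow x t ht0 htT
  have h2 := hB x t ht0 htT
  have h3 := soundSpeed_nonneg (K := K) (γ := γ) (hpos x)
  gcongr

lemma exists_characteristic (hγ : 0 < γ)
    (hτ : ContDiff ℝ 1 (fun p : ℝ × ℝ => τ p.1 p.2)) {m T : ℝ} (hm : 0 < m) (hT : 0 ≤ T)
    (hlow : ∀ x t, 0 ≤ t → t ≤ T → m ≤ τ x t) {L : NNReal}
    (hL : ∀ t, 0 ≤ t → t ≤ T → LipschitzWith L (fun y => soundSpeed K γ τ y t))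
    {σ : ℝ} (hσ : |σ| = 1) (x₀ : ℝ) :
    ∃ X : ℝ → ℝ, X 0 = x₀ ∧ ∀ t ∈ Icc 0 T,
      HasDerivWithinAt X (σ * soundSpeed K γ τ (X t) t) (Icc 0 T) t := by
  set Λ : NNReal := (Real.sqrt (K * γ) * m ^ (-(γ + 1) / 2)).toNNReal with hΛ
  have hpl : IsPicardLindelof (fun t x => σ * soundSpeed K γ τ x t)
      (⟨0, left_mem_Icc.2 hT⟩ : Icc (0 : ℝ) T) x₀ (Λ * T.toNNReal) 0 Λ L := by
    refine ⟨fun t ht => ?_, fun x _ => ?_, fun t ht x _ => ?_, ?_⟩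
    · refine LipschitzWith.lipschitzOnWith ?_
      refine LipschitzWith.of_dist_le_mul fun x y => ?_
      rw [Real.dist_eq, ← mul_sub, abs_mul, hσ, one_mul, ← Real.dist_eq]
      exact (hL t ht.1 ht.2).dist_le_mul x y
    · refine continuousOn_const.mul (continuousOn_const.mul ?_)
      refine ContinuousOn.rpow_const ?_ fun t ht => Or.inl (hm.trans_le (hlow x t ht.1 ht.2)).ne'
      exact (hτ.continuous.comp (by fun_prop : Continuous fun t : ℝ => (x, t))).continuousOn
    · rw [Real.norm_eq_abs, abs_mul, hσ, one_mul,
        abs_of_nonneg (soundSpeed_nonneg (hm.trans_le (hlow x t ht.1 ht.2))), hΛ,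
        Real.coe_toNNReal _ (by positivity)]
      exact soundSpeed_le_of_le hγ hm (hlow x t ht.1 ht.2)
    · simp [hT]
  exact hpl.exists_eq_forall_mem_Icc_hasDerivWithinAt₀

end Characteristics

section GradientTransport

variable {K γ α lam : ℝ} {τ u : ℝ → ℝ → ℝ}

/-- The space derivative `u_x + σ φ_x` of a Riemann invariant, expressed through `τ_x` and `u_x`. -/
noncomputable def riemannGrad (K γ σ : ℝ) (τ u : ℝ → ℝ → ℝ) (x t : ℝ) : ℝ :=
  pdx u x t - σ * soundSpeed K γ τ x t * pdx τ x t

lemma continuousOn_soundSpeed (hsol : IsSol K γ α lam τ u) :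
    ContinuousOn (fun p : ℝ × ℝ => soundSpeed K γ τ p.1 p.2) {p | 0 ≤ p.2} := by
  refine continuousOn_const.mul (hsol.1.continuous.continuousOn.rpow_const fun p hp => ?_)
  exact Or.inl (hsol.2.2.1 _ _ hp).ne'

lemma continuousOn_riemannGrad (σ : ℝ) (hsol : IsSol K γ α lam τ u) :
    ContinuousOn (fun p : ℝ × ℝ => riemannGrad K γ σ τ u p.1 p.2) {p | 0 ≤ p.2} :=
  (continuous_pdx hsol.2.1).continuousOn.sub
    ((continuousOn_const.mul (continuousOn_soundSpeed hsol)).mul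
      (continuous_pdx hsol.1).continuousOn)

lemma continuousOn_damping (α lam : ℝ) : ContinuousOn (fun t : ℝ => α / (1 + t) ^ lam) (Ici 0) := by
  refine continuousOn_const.div (ContinuousOn.rpow_const (by fun_prop) fun t ht => ?_) fun t ht => ?_
  · exact Or.inl (by linarith [mem_Ici.1 ht])
  · exact (Real.rpow_pos_of_pos (by linarith [mem_Ici.1 ht]) _).ne'

lemma hasDerivAt_riemann (hγ : 1 < γ) (hsol : IsSol K γ α lam τ u) (σ : ℝ) {x t : ℝ}
    (ht : 0 ≤ t) :
    HasDerivAt (fun y => u y t + σ * Phi K γ τ y t) (riemannGrad K γ σ τ u x t) x := by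
  have hφ := hasDerivWithinAt_Phi_along_curve (K := K) hγ (X := id) (Θ := fun _ => t) (s := x)
    (S := univ) (hasDerivAt_pdx hsol.1 x t).hasDerivWithinAt (hsol.2.2.1 x t ht)
  refine ((hasDerivAt_pdx hsol.2.1 x t).add
    ((hasDerivWithinAt_univ.1 hφ).const_mul σ)).congr_deriv ?_
  simp only [riemannGrad, id]
  ring

lemma hasDerivWithinAt_riemann_shift (hK : 0 < K) (hγ : 1 < γ)
    (hsol : IsSol K γ α lam τ u) {σ : ℝ} (hσ : σ ^ 2 = 1) {X : ℝ → ℝ} {t : ℝ} {S : Set ℝ}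
    (ht : 0 ≤ t) (hX : HasDerivWithinAt X (σ * soundSpeed K γ τ (X t) t) S t) (h : ℝ) :
    HasDerivWithinAt (fun r => u (X r + h) r + σ * Phi K γ τ (X r + h) r)
      (-(α / (1 + t) ^ lam) * u (X t + h) t
        - σ * (soundSpeed K γ τ (X t + h) t - soundSpeed K γ τ (X t) t)
          * riemannGrad K γ σ τ u (X t + h) t) S t := by
  have hX' := hX.add_const h
  have hu := hasDerivWithinAt_along_curve hsol.2.1 hX' (hasDerivWithinAt_id t S)
  have hφ := hasDerivWithinAt_Phi_along_curve (K := K) hγ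
    (hasDerivWithinAt_along_curve hsol.1 hX' (hasDerivWithinAt_id t S)) (hsol.2.2.1 _ _ ht)
  refine (hu.add (hφ.const_mul σ)).congr_deriv ?_
  simp only [id]
  rw [pdt_velocity hK (by linarith) hsol ht, hsol.2.2.2.1 _ _ ht, riemannGrad]
  linear_combination (-soundSpeed K γ τ (X t + h) t ^ 2 * pdx τ (X t + h) t) * hσ

lemma hasDerivWithinAt_integral_Icc {g : ℝ → ℝ} {T t : ℝ} (hg : ContinuousOn g (Icc 0 T))
    (ht : t ∈ Icc 0 T) :
    HasDerivWithinAt (fun s => ∫ r in (0 : ℝ)..s, g r) (g t) (Icc 0 T) t := by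
  have : Fact (t ∈ Icc 0 T) := ⟨ht⟩
  refine intervalIntegral.integral_hasDerivWithinAt_right ?_
    (hg.stronglyMeasurableAtFilter_nhdsWithin measurableSet_Icc t) (hg t ht)
  refine ContinuousOn.intervalIntegrable (hg.mono ?_)
  rw [uIcc_of_le ht.1]
  exact Icc_subset_Icc le_rfl ht.2

open Filter Topology in
lemma tendsto_differenceQuotient {f : ℝ → ℝ} {f' x : ℝ} (hf : HasDerivAt f f' x) :
    Tendsto (fun h => (f (x + h) - f x) / h) (𝓝[≠] 0) (𝓝 f') := by
  refine (hasDerivAt_iff_tendsto_slope_zero.1 hf).congr fun h => ?_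
  rw [smul_eq_mul, div_eq_inv_mul]

open Filter Topology in
lemma hasDerivWithinAt_riemannGrad (hK : 0 < K) (hγ : 1 < γ)
    (hsol : IsSol K γ α lam τ u) {m B T : ℝ} (hm : 0 < m)
    (hlow : ∀ x t, 0 ≤ t → t ≤ T → m ≤ τ x t)
    (hB : ∀ x t, 0 ≤ t → t ≤ T → |pdx τ x t| + |pdx u x t| ≤ B)
    {L : NNReal} (hL : ∀ t, 0 ≤ t → t ≤ T → LipschitzWith L (fun y => soundSpeed K γ τ y t))
    {σ : ℝ} (hσ : |σ| = 1) {X : ℝ → ℝ}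
    (hX : ∀ t ∈ Icc 0 T, HasDerivWithinAt X (σ * soundSpeed K γ τ (X t) t) (Icc 0 T) t)
    {t : ℝ} (ht : t ∈ Icc 0 T) :
    HasDerivWithinAt (fun s => riemannGrad K γ σ τ u (X s) s)
      (-(α / (1 + t) ^ lam) * pdx u (X t) t
        - σ * (-((γ + 1) / 2) * soundSpeed K γ τ (X t) t / τ (X t) t * pdx τ (X t) t)
          * riemannGrad K γ σ τ u (X t) t) (Icc 0 T) t := by
  have hσ2 : σ ^ 2 = 1 := by rw [← sq_abs, hσ, one_pow]
  have hXc : ContinuousOn X (Icc 0 T) := fun s hs => (hX s hs).continuousWithinAt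
  have hcurve (h : ℝ) : ContinuousOn (fun s => (X s + h, s)) (Icc 0 T) :=
    (hXc.add continuousOn_const).prodMk continuousOn_id
  have hmaps (h : ℝ) : MapsTo (fun s => (X s + h, s)) (Icc 0 T) {p : ℝ × ℝ | 0 ≤ p.2} :=
    fun s hs => hs.1
  have hcu (h : ℝ) : ContinuousOn (fun s => u (X s + h) s) (Icc 0 T) :=
    hsol.2.1.continuous.comp_continuousOn (hcurve h)
  have hcc (h : ℝ) : ContinuousOn (fun s => soundSpeed K γ τ (X s + h) s) (Icc 0 T) :=
    (continuousOn_soundSpeed hsol).comp (hcurve h) (hmaps h)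
  have hcw (h : ℝ) : ContinuousOn (fun s => riemannGrad K γ σ τ u (X s + h) s) (Icc 0 T) :=
    (continuousOn_riemannGrad σ hsol).comp (hcurve h) (hmaps h)
  have hca : ContinuousOn (fun s : ℝ => α / (1 + s) ^ lam) (Icc 0 T) :=
    (continuousOn_damping α lam).mono Icc_subset_Ici_self
  set g : ℝ → ℝ := fun s => -(α / (1 + s) ^ lam) * pdx u (X s) s
        - σ * (-((γ + 1) / 2) * soundSpeed K γ τ (X s) s / τ (X s) s * pdx τ (X s) s)
          * riemannGrad K γ σ τ u (X s) s with hg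
  have hgc : ContinuousOn g (Icc 0 T) := by
    have hc0 : ContinuousOn (fun s => (X s, s)) (Icc 0 T) := hXc.prodMk continuousOn_id
    have h1 : ContinuousOn (fun s => pdx u (X s) s) (Icc 0 T) :=
      (continuous_pdx hsol.2.1).comp_continuousOn hc0
    have h2 : ContinuousOn (fun s => pdx τ (X s) s) (Icc 0 T) :=
      (continuous_pdx hsol.1).comp_continuousOn hc0
    have h3 : ContinuousOn (fun s => τ (X s) s) (Icc 0 T) :=
      hsol.1.continuous.comp_continuousOn hc0
    have h4 := hcc 0
    have h5 := hcw 0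
    simp only [add_zero] at h4 h5
    exact (hca.neg.mul h1).sub ((continuousOn_const.mul
      (((continuousOn_const.mul h4).div h3 fun s hs => (hsol.2.2.1 _ _ hs.1).ne').mul h2)).mul h5)
  set D : ℝ → ℝ → ℝ := fun h s =>
    -(α / (1 + s) ^ lam) * ((u (X s + h) s - u (X s) s) / h)
      - σ * ((soundSpeed K γ τ (X s + h) s - soundSpeed K γ τ (X s) s) / h)
        * riemannGrad K γ σ τ u (X s + h) s with hD
  have hDc (h : ℝ) : ContinuousOn (D h) (Icc 0 T) := by
    have h3 := hcu 0
    have h4 := hcc 0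
    simp only [add_zero] at h3 h4
    exact (hca.neg.mul (((hcu h).sub h3).div_const h)).sub
      ((continuousOn_const.mul (((hcc h).sub h4).div_const h)).mul (hcw h))
  set Q : ℝ → ℝ → ℝ := fun h s =>
    ((u (X s + h) s + σ * Phi K γ τ (X s + h) s) - (u (X s) s + σ * Phi K γ τ (X s) s)) / h with hQ
  have hQd (h s : ℝ) (hs : s ∈ Icc 0 T) : HasDerivWithinAt (Q h) (D h s) (Icc 0 T) s := by
    have h1 := hasDerivWithinAt_riemann_shift hK hγ hsol hσ2 hs.1 (hX s hs) h
    have h0 := hasDerivWithinAt_riemann_shift hK hγ hsol hσ2 hs.1 (hX s hs) 0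
    simp only [add_zero, sub_self, mul_zero, zero_mul, sub_zero] at h0
    refine ((h1.sub h0).div_const h).congr_deriv ?_
    simp only [hD]
    ring
  have hint (h s : ℝ) (hs : s ∈ Icc 0 T) : ∫ r in (0 : ℝ)..s, D h r = Q h s - Q h 0 := by
    have hsub : Icc 0 s ⊆ Icc 0 T := Icc_subset_Icc le_rfl hs.2
    refine intervalIntegral.integral_eq_sub_of_hasDerivAt_of_le hs.1
      (fun r hr => (hQd h r (hsub hr)).continuousWithinAt.mono hsub) (fun r hr => ?_) ?_
    · exact (hQd h r (hsub (Ioo_subset_Icc_self hr))).hasDerivAt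
        (Icc_mem_nhds hr.1 (hr.2.trans_le hs.2))
    · refine ContinuousOn.intervalIntegrable ((hDc h).mono ?_)
      rwa [uIcc_of_le hs.1]
  have hQlim (s : ℝ) (hs : s ∈ Icc 0 T) :
      Tendsto (fun h => Q h s) (𝓝[≠] 0) (𝓝 (riemannGrad K γ σ τ u (X s) s)) :=
    tendsto_differenceQuotient (hasDerivAt_riemann hγ hsol σ hs.1)
  have hDlim (s : ℝ) (hs : s ∈ Icc 0 T) : Tendsto (fun h => D h s) (𝓝[≠] 0) (𝓝 (g s)) := by
    have h1 := tendsto_differenceQuotient (hasDerivAt_pdx hsol.2.1 (X s) s)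
    have h2 := tendsto_differenceQuotient
      (hasDerivAt_soundSpeed (K := K) (γ := γ) hsol.1 (hsol.2.2.1 (X s) s hs.1))
    have h3 : Tendsto (fun h => riemannGrad K γ σ τ u (X s + h) s) (𝓝[≠] 0)
        (𝓝 (riemannGrad K γ σ τ u (X s) s)) := by
      have h4 : Continuous (fun h : ℝ => riemannGrad K γ σ τ u (X s + h) s) :=
        (continuousOn_riemannGrad σ hsol).comp_continuous
          (by fun_prop : Continuous fun h : ℝ => (X s + h, s)) fun _ => hs.1
      have h5 := (h4.tendsto 0).mono_left (nhdsWithin_le_nhds (s := {0}ᶜ))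
      simpa using h5
    exact (h1.const_mul _).sub ((h2.const_mul σ).mul h3)
  set Λ := Real.sqrt (K * γ) * m ^ (-(γ + 1) / 2) with hΛ
  have hT : 0 ≤ T := ht.1.trans ht.2
  have hB0 : 0 ≤ B := le_trans (by positivity) (hB 0 0 le_rfl hT)
  have hpx (x s : ℝ) (hs : s ∈ Icc 0 T) : |pdx τ x s| ≤ B := by
    linarith [hB x s hs.1 hs.2, abs_nonneg (pdx u x s)]
  have hqx (x s : ℝ) (hs : s ∈ Icc 0 T) : |pdx u x s| ≤ B := by
    linarith [hB x s hs.1 hs.2, abs_nonneg (pdx τ x s)]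
  have hDbound (h s : ℝ) (hh : h ≠ 0) (hs : s ∈ Icc 0 T) :
      ‖D h s‖ ≤ |α / (1 + s) ^ lam| * B + L * (B + Λ * B) := by
    have hh' : 0 < |h| := abs_pos.2 hh
    have e1 : |(u (X s + h) s - u (X s) s) / h| ≤ B := by
      have := convex_univ.norm_image_sub_le_of_norm_hasDerivWithin_le
        (f := fun y => u y s) (f' := fun y => pdx u y s) (C := B)
        (fun y _ => (hasDerivAt_pdx hsol.2.1 y s).hasDerivWithinAt)
        (fun y _ => hqx y s hs) (mem_univ (X s)) (mem_univ (X s + h))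
      rw [abs_div, div_le_iff₀ hh']
      simpa using this
    have e2 : |(soundSpeed K γ τ (X s + h) s - soundSpeed K γ τ (X s) s) / h| ≤ L := by
      have := (hL s hs.1 hs.2).dist_le_mul (X s + h) (X s)
      rw [abs_div, div_le_iff₀ hh']
      simpa [Real.dist_eq] using this
    have e3 : |riemannGrad K γ σ τ u (X s + h) s| ≤ B + Λ * B := by
      refine (abs_sub _ _).trans (add_le_add (hqx _ s hs) ?_)
      rw [abs_mul, abs_mul, hσ, one_mul, abs_of_nonneg (soundSpeed_nonneg (hsol.2.2.1 _ _ hs.1))]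
      exact mul_le_mul (soundSpeed_le_of_le (by linarith) hm (hlow _ s hs.1 hs.2)) (hpx _ s hs)
        (abs_nonneg _) (by positivity)
    rw [Real.norm_eq_abs]
    refine (abs_sub _ _).trans (add_le_add ?_ ?_)
    · rw [abs_mul, abs_neg]
      exact mul_le_mul_of_nonneg_left e1 (abs_nonneg _)
    · rw [abs_mul, abs_mul, hσ, one_mul]
      exact mul_le_mul e2 e3 (abs_nonneg _) L.2
  have hrep (s : ℝ) (hs : s ∈ Icc 0 T) : riemannGrad K γ σ τ u (X s) s =
      riemannGrad K γ σ τ u (X 0) 0 + ∫ r in (0 : ℝ)..s, g r := by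
    have hsub : Icc 0 s ⊆ Icc 0 T := Icc_subset_Icc le_rfl hs.2
    have hmem {r : ℝ} (hr : r ∈ uIoc 0 s) : r ∈ Icc 0 T := by
      rw [uIoc_of_le hs.1] at hr
      exact hsub ⟨hr.1.le, hr.2⟩
    have hlim : Tendsto (fun h => ∫ r in (0 : ℝ)..s, D h r) (𝓝[≠] 0)
        (𝓝 (∫ r in (0 : ℝ)..s, g r)) := by
      refine intervalIntegral.tendsto_integral_filter_of_dominated_convergence
        (fun r => |α / (1 + r) ^ lam| * B + L * (B + Λ * B)) ?_ ?_ ?_ ?_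
      · exact Eventually.of_forall fun h =>
          ((hDc h).mono fun r hr => hmem hr).aestronglyMeasurable measurableSet_uIoc
      · filter_upwards [self_mem_nhdsWithin] with h hh
        exact ae_of_all _ fun r hr => hDbound h r hh (hmem hr)
      · refine ContinuousOn.intervalIntegrable ?_
        rw [uIcc_of_le hs.1]
        exact ((hca.mono hsub).abs.mul continuousOn_const).add continuousOn_const
      · exact ae_of_all _ fun r hr => hDlim r (hmem hr)
    have hlim2 : Tendsto (fun h => ∫ r in (0 : ℝ)..s, D h r) (𝓝[≠] 0)
        (𝓝 (riemannGrad K γ σ τ u (X s) s - riemannGrad K γ σ τ u (X 0) 0)) := by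
      simp only [hint _ s hs]
      exact (hQlim s hs).sub (hQlim 0 (left_mem_Icc.2 hT))
    linarith [tendsto_nhds_unique hlim hlim2]
  have hfin := (hasDerivWithinAt_integral_Icc hgc ht).const_add
    (riemannGrad K γ σ τ u (X 0) 0)
  exact hfin.congr hrep (hrep t ht)

end GradientTransport

section Riccati

lemma false_of_riccati {Z Z' : ℝ → ℝ} {M β : ℝ} (hM : 0 < M) (hβ : 0 < β) (hMβ : 1 < M * β)
    (hd : ∀ t ∈ Icc (0 : ℝ) 1, HasDerivWithinAt Z (Z' t) (Icc 0 1) t) (h0 : Z 0 ≤ -M)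
    (hZ : ∀ t ∈ Icc (0 : ℝ) 1, Z t ≤ -M → Z' t ≤ -β * Z t ^ 2) : False := by
  have hc : ContinuousOn Z (Icc 0 1) := fun t ht => (hd t ht).continuousWithinAt
  have hr : ∀ t ∈ Ico (0 : ℝ) 1, HasDerivWithinAt Z (Z' t) (Ici t) t := fun t ht =>
    (hd t (Ico_subset_Icc_self ht)).mono_of_mem_nhdsWithin (Icc_mem_nhdsGE_of_mem ht)
  have hle : ∀ ⦃t⦄, t ∈ Icc (0 : ℝ) 1 → Z t ≤ -M := by
    refine image_le_of_deriv_right_lt_deriv_boundary hc hr h0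
      (fun t => hasDerivAt_const t (-M)) fun t ht he => ?_
    have h1 := hZ t (Ico_subset_Icc_self ht) he.le
    rw [he] at h1
    nlinarith [mul_pos hβ (pow_pos hM 2)]
  have hneg (t : ℝ) (ht : t ∈ Icc (0 : ℝ) 1) : Z t < 0 := by linarith [hle ht]
  have hinv : ∀ ⦃t⦄, t ∈ Icc (0 : ℝ) 1 → -(Z t)⁻¹ ≤ M⁻¹ - β * t := by
    refine image_le_of_deriv_right_le_deriv_boundary (f' := fun t => Z' t / Z t ^ 2)
      (B' := fun _ => -β) (hc.inv₀ fun t ht => (hneg t ht).ne).neg (fun t ht => ?_) ?_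
      (by fun_prop) (fun t _ => ?_) fun t ht => ?_
    · refine ((hr t ht).fun_inv (hneg t (Ico_subset_Icc_self ht)).ne).fun_neg.congr_deriv ?_
      ring
    · rw [mul_zero, sub_zero, ← inv_neg]
      exact inv_anti₀ hM (show M ≤ -Z 0 by linarith)
    · have := ((hasDerivAt_id t).const_mul β).const_sub M⁻¹
      simpa using this.hasDerivWithinAt
    · have hz := (hneg t (Ico_subset_Icc_self ht)).ne
      rw [div_le_iff₀ (by positivity)]
      exact hZ t (Ico_subset_Icc_self ht) (hle (Ico_subset_Icc_self ht))
  have h1 := hinv (right_mem_Icc.2 zero_le_one)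
  have h2 : 0 < -(Z 1)⁻¹ := by
    rw [← inv_neg]
    exact inv_pos.2 (by linarith [hneg 1 (right_mem_Icc.2 zero_le_one)])
  have h3 : M⁻¹ < β := by
    rw [inv_lt_iff_one_lt_mul₀ hM]
    rwa [mul_comm]
  linarith

lemma riccati_bound {A P M b a a' κ ψ y z : ℝ} (hb : 0 < b) (hA : 0 ≤ A)
    (hM1 : 2 * (A * P) ≤ M) (hM2 : 16 ≤ b * M) (hM3 : 16 * A ≤ b * M)
    (ha0 : 0 ≤ a) (haA : a ≤ A) (ha' : |a'| ≤ A) (hψ0 : 0 ≤ ψ) (hψ : ψ ≤ P) (hκ : b ≤ κ)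
    (hz : z = y - a * ψ) (hzM : z ≤ -M) :
    -κ * y ^ 2 - a / 2 * y - a' * ψ ≤ -(b / 8) * z ^ 2 := by
  have hM : 0 < M := by
    by_contra! h
    nlinarith
  have h1 : a * ψ ≤ A * P := mul_le_mul haA hψ hψ0 hA
  have h0 : 0 ≤ a * ψ := mul_nonneg ha0 hψ0
  have hy1 : -y ≤ -z := by linarith
  have hy2 : -z / 2 ≤ -y := by linarith
  have e1 : z ^ 2 / 4 ≤ y ^ 2 := by nlinarith
  have e2 : b * (z ^ 2 / 4) ≤ κ * y ^ 2 :=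
    mul_le_mul hκ e1 (by positivity) (hb.le.trans hκ)
  have e3 : -(a / 2 * y) ≤ A / 2 * (-z) := by
    have : a * (-y) ≤ A * (-z) := mul_le_mul haA hy1 (by linarith) hA
    linarith
  have hbz : b * M ≤ b * (-z) := mul_le_mul_of_nonneg_left (by linarith) hb.le
  have e4 : 16 * A * (-z) ≤ b * (-z) * (-z) :=
    mul_le_mul_of_nonneg_right (by linarith) (by linarith)
  have e5 : -(a' * ψ) ≤ A * P := by
    have : |a'| * ψ ≤ A * P := mul_le_mul ha' hψ hψ0 hA
    have h2 : -a' * ψ ≤ |a'| * ψ := mul_le_mul_of_nonneg_right (neg_le_abs a') hψ0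
    linarith
  have e6 : 16 * (-z) ≤ b * (-z) * (-z) :=
    mul_le_mul_of_nonneg_right (by linarith) (by linarith)
  nlinarith

end Riccati

section Blowup

variable {K γ α lam : ℝ} {τ u : ℝ → ℝ → ℝ}

lemma hasDerivAt_damping (α lam : ℝ) {t : ℝ} (ht : 0 ≤ t) :
    HasDerivAt (fun s : ℝ => α / (1 + s) ^ lam) (-lam * α * (1 + t) ^ (-lam - 1)) t := by
  have h1 : HasDerivAt (fun s : ℝ => α * (1 + s) ^ (-lam))
      (α * (1 * (-lam) * (1 + t) ^ (-lam - 1))) t :=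
    (((hasDerivAt_id t).const_add 1).rpow_const (Or.inl (by simp; linarith))).const_mul α
  refine (h1.congr_of_eventuallyEq ?_).congr_deriv (by ring)
  filter_upwards [lt_mem_nhds (by linarith : -1 < t)] with s hs
  rw [Real.rpow_neg (by linarith), div_eq_mul_inv]

lemma damping_bounds (hα : 0 ≤ α) (lam : ℝ) {t : ℝ} (ht : t ∈ Icc (0 : ℝ) 1) :
    α / (1 + t) ^ lam ≤ (1 + |lam|) * α * 2 ^ |lam| ∧
      |(-lam * α * (1 + t) ^ (-lam - 1))| ≤ (1 + |lam|) * α * 2 ^ |lam| := by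
  have h1 : 1 ≤ 1 + t := by linarith [ht.1]
  have h2 : 0 < 1 + t := by linarith
  have h3 : (1 + t) ^ (-lam) ≤ 2 ^ |lam| :=
    (Real.rpow_le_rpow_of_exponent_le h1 (neg_le_abs lam)).trans
      (Real.rpow_le_rpow h2.le (by linarith [ht.2]) (abs_nonneg _))
  have h4 : (1 + t) ^ (-lam - 1) ≤ 2 ^ |lam| :=
    (Real.rpow_le_rpow_of_exponent_le h1 (by linarith)).trans h3
  have h5 : 0 ≤ α * 2 ^ |lam| := by positivity
  constructor
  · rw [div_eq_mul_inv, ← Real.rpow_neg h2.le]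
    have := mul_le_mul_of_nonneg_left h3 hα
    nlinarith [mul_nonneg (abs_nonneg lam) h5]
  · rw [abs_mul, abs_mul, abs_neg, abs_of_nonneg hα,
      abs_of_nonneg (Real.rpow_nonneg h2.le _)]
    have := mul_le_mul_of_nonneg_left h4 (mul_nonneg (abs_nonneg lam) hα)
    nlinarith

/-- The weighted gradient, corrected by a potential, solves a Riccati equation along
characteristics. -/
lemma hasDerivWithinAt_weighted_riemannGrad (hK : 0 < K) (hγ : 3 < γ)
    (hsol : IsSol K γ α lam τ u) {m B T : ℝ} (hm : 0 < m)
    (hlow : ∀ x t, 0 ≤ t → t ≤ T → m ≤ τ x t)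
    (hB : ∀ x t, 0 ≤ t → t ≤ T → |pdx τ x t| + |pdx u x t| ≤ B)
    {L : NNReal} (hL : ∀ t, 0 ≤ t → t ≤ T → LipschitzWith L (fun y => soundSpeed K γ τ y t))
    {σ : ℝ} (hσ : |σ| = 1) {X : ℝ → ℝ}
    (hX : ∀ t ∈ Icc 0 T, HasDerivWithinAt X (σ * soundSpeed K γ τ (X t) t) (Icc 0 T) t)
    {t : ℝ} (ht : t ∈ Icc 0 T) :
    HasDerivWithinAt (fun s => τ (X s) s ^ (-(γ + 1) / 4) * riemannGrad K γ σ τ u (X s) s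
        - α / (1 + s) ^ lam * (2 / (γ - 3) * τ (X s) s ^ ((3 - γ) / 4)))
      (-((γ + 1) / 4 * τ (X t) t ^ ((γ - 3) / 4))
          * (τ (X t) t ^ (-(γ + 1) / 4) * riemannGrad K γ σ τ u (X t) t) ^ 2
        - α / (1 + t) ^ lam / 2 * (τ (X t) t ^ (-(γ + 1) / 4) * riemannGrad K γ σ τ u (X t) t)
        - (-lam * α * (1 + t) ^ (-lam - 1)) * (2 / (γ - 3) * τ (X t) t ^ ((3 - γ) / 4)))
      (Icc 0 T) t := by
  have hpos := hsol.2.2.1 (X t) t ht.1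
  have hτ := hasDerivWithinAt_along_curve hsol.1 (hX t ht) (hasDerivWithinAt_id t (Icc 0 T))
  have hw := hasDerivWithinAt_riemannGrad hK (by linarith) hsol hm hlow hB hL hσ hX ht
  have h1 := (hτ.rpow_const (p := -(γ + 1) / 4) (Or.inl hpos.ne')).mul hw
  have h2 := (hasDerivAt_damping α lam ht.1).hasDerivWithinAt (s := Icc 0 T) |>.mul
    ((hτ.rpow_const (p := (3 - γ) / 4) (Or.inl hpos.ne')).const_mul (2 / (γ - 3)))
  refine (h1.sub h2).congr_deriv ?_
  simp only [id, one_mul]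
  have hγ3 : γ - 3 ≠ 0 := by linarith
  have e1 : τ (X t) t ^ (-(γ + 1) / 4 - 1) = τ (X t) t ^ (-(γ + 1) / 4) / τ (X t) t :=
    Real.rpow_sub_one hpos.ne' _
  have e2 : (3 - γ) / 4 - 1 = -(γ + 1) / 4 := by ring
  have e3 : τ (X t) t ^ ((γ - 3) / 4) = (τ (X t) t ^ (-(γ + 1) / 4))⁻¹ / τ (X t) t := by
    rw [← Real.rpow_neg hpos.le, ← Real.rpow_sub_one hpos.ne']
    congr 1
    ring
  rw [e1, e2, e3, hsol.2.2.2.1 _ _ ht.1]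
  have hP : τ (X t) t ^ (-(γ + 1) / 4) ≠ 0 := (Real.rpow_pos_of_pos hpos _).ne'
  have hτ0 := hpos.ne'
  generalize τ (X t) t ^ (-(γ + 1) / 4) = P at *
  generalize τ (X t) t ^ ((3 - γ) / 4) = R at *
  generalize (1 + t) ^ (-lam - 1) = d at *
  generalize α / (1 + t) ^ lam = a at *
  rw [riemannGrad]
  field_simp
  ring

/-- A sufficiently negative weighted gradient at the initial time leads to blow-up by time `1`. -/
lemma exists_threshold_blowsUp (hK : 0 < K) (hγ : 3 < γ) (hα : 0 ≤ α) (lam : ℝ) {C₀ : ℝ}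
    (hC₀ : 0 < C₀) :
    ∃ M > (0 : ℝ), ∀ (τ u : ℝ → ℝ → ℝ), IsSol K γ α lam τ u →
      (∀ x, |u x 0| ≤ C₀) → (∀ x, C₀⁻¹ < τ x 0) → ∀ σ x₀ : ℝ, |σ| = 1 →
      τ x₀ 0 ^ (-(γ + 1) / 4) * riemannGrad K γ σ τ u x₀ 0 ≤ -M → BlowsUp τ u := by
  obtain ⟨m, hm, hmlow⟩ := exists_pos_le_tau hK (by linarith : 1 < γ) hC₀
  have hγ3 : 0 < γ - 3 := by linarith
  set A : ℝ := (1 + |lam|) * α * 2 ^ |lam| with hA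
  set P : ℝ := 2 / (γ - 3) * m ^ ((3 - γ) / 4) with hP
  set b : ℝ := (γ + 1) / 4 * m ^ ((γ - 3) / 4) with hb
  have hA0 : 0 ≤ A := by positivity
  have hP0 : 0 ≤ P := by positivity
  have hb0 : 0 < b := mul_pos (by linarith) (Real.rpow_pos_of_pos hm _)
  set M : ℝ := 2 * (A * P) + (16 + 16 * A) / b with hM
  have hAP : 0 ≤ A * P := mul_nonneg hA0 hP0
  have hM0 : 0 < M := by positivity
  have hM1 : 2 * (A * P) ≤ M := le_add_of_nonneg_right (by positivity)
  have hbM : 16 + 16 * A ≤ b * M := by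
    rw [hM, mul_add, mul_div_cancel₀ _ hb0.ne']
    exact le_add_of_nonneg_left (by positivity)
  refine ⟨M, hM0, fun τ u hsol hu0 hτ0 σ x₀ hσ hinit => ⟨1, one_pos, fun hbdd => ?_⟩⟩
  obtain ⟨B, hB'⟩ := hbdd
  have hB (x t : ℝ) (ht0 : 0 ≤ t) (ht1 : t ≤ 1) : |pdx τ x t| + |pdx u x t| ≤ B :=
    hB' ⟨x, t, ht0, ht1, rfl⟩
  have hlow := hmlow α lam τ u hα hsol hu0 hτ0 B 1 hB
  obtain ⟨L, hL⟩ := exists_lipschitz_soundSpeed (K := K) (by linarith : 0 < γ) hsol.1 hm hlow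
    fun x t h0 h1 => (le_add_of_nonneg_right (abs_nonneg _)).trans (hB x t h0 h1)
  obtain ⟨X, hX0, hX⟩ := exists_characteristic (K := K) (by linarith : 0 < γ) hsol.1 hm
    zero_le_one hlow hL hσ x₀
  refine false_of_riccati hM0 (β := b / 8) (by positivity) (by nlinarith)
    (fun t ht => hasDerivWithinAt_weighted_riemannGrad hK hγ hsol hm hlow hB hL hσ hX ht)
    ?_ fun t ht hz => ?_
  · have hp := hsol.2.2.1 x₀ 0 le_rfl
    have : 0 ≤ α / (1 + 0 : ℝ) ^ lam * (2 / (γ - 3) * τ x₀ 0 ^ ((3 - γ) / 4)) := by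
      positivity
    simp only [hX0]
    linarith
  · have hp := hsol.2.2.1 (X t) t ht.1
    have hl := hlow (X t) t ht.1 ht.2
    have hd := damping_bounds hα lam ht
    have ht0 : 0 < 1 + t := by linarith [ht.1]
    refine riccati_bound hb0 hA0 hM1 (by linarith) (by linarith) (by positivity) hd.1 hd.2
      (by positivity) ?_ ?_ rfl hz
    · exact mul_le_mul_of_nonneg_left
        (Real.rpow_le_rpow_of_nonpos hm hl (by linarith)) (by positivity)
    · exact mul_le_mul_of_nonneg_left
        (Real.rpow_le_rpow hm.le hl (by linarith)) (by linarith)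

end Blowup

theorem stmt5 (K γ α lam C₀ : ℝ) (hK : 0 < K) (hγ : 3 < γ)
    (hα : 0 ≤ α) (hlam : lam ≠ 1) (hC₀ : 0 < C₀) :
    ∃ K₅ > (0 : ℝ), ∃ K₆ > (0 : ℝ),
      ∀ (τ₀ u₀ : ℝ → ℝ), ContDiff ℝ 1 τ₀ → ContDiff ℝ 1 u₀ →
        (∀ x, |u₀ x| ≤ C₀) → (∀ x, C₀⁻¹ < τ₀ x) →
      ∀ (τ u : ℝ → ℝ → ℝ), IsSol K γ α lam τ u →
        (∀ x, τ x 0 = τ₀ x ∧ u x 0 = u₀ x) →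
      ∀ x₀ : ℝ,
        (pdx u x₀ 0 + pdx (Phi K γ τ) x₀ 0 <
            K₅ * Phi K γ τ x₀ 0 ^ (-2 / (γ - 1)) -
              K₆ * Phi K γ τ x₀ 0 ^ (-(γ + 1) / (2 * (γ - 1))) ∨
         pdx u x₀ 0 - pdx (Phi K γ τ) x₀ 0 <
            K₅ * Phi K γ τ x₀ 0 ^ (-2 / (γ - 1)) -
              K₆ * Phi K γ τ x₀ 0 ^ (-(γ + 1) / (2 * (γ - 1)))) →
        BlowsUp τ u := by
  have hγ1 : 0 < γ - 1 := by linarith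
  obtain ⟨M, hM, hblow⟩ := exists_threshold_blowsUp hK hγ hα lam hC₀
  set A : ℝ := 2 * Real.sqrt (K * γ) / (γ - 1) with hA
  have hA0 : 0 < A := by
    have : 0 < Real.sqrt (K * γ) := Real.sqrt_pos.2 (mul_pos hK (by linarith))
    positivity
  set N : ℝ := C₀⁻¹ ^ ((3 - γ) / 4) with hN
  have hN0 : 0 < N := by positivity
  refine ⟨A ^ (2 / (γ - 1)), by positivity, A ^ ((γ + 1) / (2 * (γ - 1))) * (M + N),
    by positivity, fun τ₀ u₀ _ _ hu₀ hτ₀ τ u hsol hinit x₀ hx₀ => ?_⟩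
  have hτ (x : ℝ) : C₀⁻¹ < τ x 0 := (hinit x).1 ▸ hτ₀ x
  have hu (x : ℝ) : |u x 0| ≤ C₀ := (hinit x).2 ▸ hu₀ x
  have hp := hsol.2.2.1 x₀ 0 le_rfl
  have hpow (e : ℝ) : Phi K γ τ x₀ 0 ^ e = A ^ e * τ x₀ 0 ^ (-(γ - 1) / 2 * e) := by
    rw [Phi, Real.mul_rpow hA0.le (by positivity), ← Real.rpow_mul hp.le]
  have hrhs : A ^ (2 / (γ - 1)) * Phi K γ τ x₀ 0 ^ (-2 / (γ - 1)) -
      A ^ ((γ + 1) / (2 * (γ - 1))) * (M + N) * Phi K γ τ x₀ 0 ^ (-(γ + 1) / (2 * (γ - 1))) =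
      τ x₀ 0 - (M + N) * τ x₀ 0 ^ ((γ + 1) / 4) := by
    have e1 : A ^ (2 / (γ - 1)) * A ^ (-2 / (γ - 1)) = 1 := by
      rw [← Real.rpow_add hA0, ← add_div]
      norm_num
    have e2 : A ^ ((γ + 1) / (2 * (γ - 1))) * A ^ (-(γ + 1) / (2 * (γ - 1))) = 1 := by
      rw [← Real.rpow_add hA0, ← add_div, add_neg_cancel, zero_div, Real.rpow_zero]
    rw [hpow, hpow, show -(γ - 1) / 2 * (-2 / (γ - 1)) = 1 by field_simp,
      show -(γ - 1) / 2 * (-(γ + 1) / (2 * (γ - 1))) = (γ + 1) / 4 by field_simp; ring,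
      Real.rpow_one]
    linear_combination τ x₀ 0 * e1 - (M + N) * τ x₀ 0 ^ ((γ + 1) / 4) * e2
  have key (σ : ℝ) (hσ : |σ| = 1)
      (h : riemannGrad K γ σ τ u x₀ 0 < τ x₀ 0 - (M + N) * τ x₀ 0 ^ ((γ + 1) / 4)) :
      BlowsUp τ u := by
    refine hblow τ u hsol hu hτ σ x₀ hσ ?_
    have h1 := mul_le_mul_of_nonneg_left h.le (Real.rpow_nonneg hp.le (-(γ + 1) / 4))
    have e1 : τ x₀ 0 ^ (-(γ + 1) / 4) * τ x₀ 0 = τ x₀ 0 ^ ((3 - γ) / 4) := by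
      rw [← Real.rpow_add_one hp.ne']
      congr 1
      ring
    have e2 : τ x₀ 0 ^ (-(γ + 1) / 4) * τ x₀ 0 ^ ((γ + 1) / 4) = 1 := by
      rw [← Real.rpow_add hp, ← add_div, neg_add_cancel, zero_div, Real.rpow_zero]
    have e3 : τ x₀ 0 ^ ((3 - γ) / 4) ≤ N :=
      Real.rpow_le_rpow_of_nonpos (inv_pos.2 hC₀) (hτ x₀).le (by linarith)
    have e4 : τ x₀ 0 ^ (-(γ + 1) / 4) * (τ x₀ 0 - (M + N) * τ x₀ 0 ^ ((γ + 1) / 4)) =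
        τ x₀ 0 ^ ((3 - γ) / 4) - (M + N) := by
      linear_combination e1 - (M + N) * e2
    linarith
  rw [hrhs, pdx_Phi (by linarith) hsol.1 hp] at hx₀
  rcases hx₀ with h | h
  · refine key 1 (by simp) (lt_of_eq_of_lt ?_ h)
    rw [riemannGrad]
    ring
  · refine key (-1) (by simp) (lt_of_eq_of_lt ?_ h)
    rw [riemannGrad]
    ring
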